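/- Let t, a, b, c be positive integers with a, b, c odd, and let r be an integer. Let S = #{(j_1, j_2, j_3, j_4) ∈ ℤ^4 : 0 ≤ j_1, j_2, j_3, j_4 < t, j_1 + j_2 = j_3 + j_4, a | (j_4 − j_2), b | (j_3 − j_2), c | (j_3 + j_4 + 2r)}. Then |S − 2t^3/(3abc)| ≤ 4572 max(t, a, b, c)^2 max(a, b, c) / (abc). -/

import Mathlib

lemma aux_sym (n : ℕ) (f : ℤ → ℝ) :
    ∑ k ∈ Finset.Icc (-((n + 1 : ℕ) : ℤ)) ((n + 1 : ℕ) : ℤ), f k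
      = ∑ k ∈ Finset.Icc (-(n : ℤ)) (n : ℤ), f k + f (n + 1) + f (-(n + 1)) := by
  have h : Finset.Icc (-((n + 1 : ℕ) : ℤ)) ((n + 1 : ℕ) : ℤ)
      = insert (-((n : ℤ) + 1)) (insert ((n : ℤ) + 1) (Finset.Icc (-(n : ℤ)) (n : ℤ))) := by
    ext x
    simp only [Finset.mem_Icc, Finset.mem_insert]
    push_cast
    omega
  rw [h, Finset.sum_insert, Finset.sum_insert]
  · ring
  · simp
  · simp only [Finset.mem_Icc, Finset.mem_insert]
    omega

lemma aux_tel (b : ℝ) (F G : ℝ → ℝ) (hb : 0 < b)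
    (h1 : ∀ x, G x - G (x + b) ≤ b * F x)
    (h2 : ∀ x, b * F (x + b) ≤ G x - G (x + b)) (n : ℕ) :
    2 * G 0 - 2 * G (b * (n + 1)) - b * F 0 ≤
        b * ∑ k ∈ Finset.Icc (-(n : ℤ)) (n : ℤ), F (b * |(k : ℝ)|) ∧
      b * ∑ k ∈ Finset.Icc (-(n : ℤ)) (n : ℤ), F (b * |(k : ℝ)|) ≤
        2 * G 0 - 2 * G (b * n) + b * F 0 := by
  induction n with
  | zero =>
    have := h1 0
    simp at this ⊢
    linarith
  | succ n ih =>
    rw [aux_sym]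
    have e1 : |(((n : ℤ) + 1 : ℤ) : ℝ)| = n + 1 := by
      push_cast
      exact abs_of_nonneg (by positivity)
    have e2 : |((-((n : ℤ) + 1) : ℤ) : ℝ)| = n + 1 := by
      rw [Int.cast_neg, abs_neg, e1]
    rw [e1, e2]
    have := h1 (b * (n + 1))
    have h2' := h2 (b * n)
    have e3 : b * (n : ℝ) + b = b * (n + 1) := by ring
    have e4 : b * ((n : ℝ) + 1) + b = b * (n + 1 + 1) := by ring
    rw [e3] at h2'
    rw [e4] at this
    push_cast
    have e5 : ∀ p q : ℝ, b * (p + q + q) = b * p + 2 * (b * q) := fun p q => by ring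
    rw [e5 (∑ k ∈ Finset.Icc (-(n : ℤ)) (n : ℤ), F (b * |(k : ℝ)|))]
    constructor <;> linarith [ih.1, ih.2]

lemma aux_lin (b s : ℝ) (hb : 0 < b) (hs : 0 ≤ s) (n : ℕ) (hn : s ≤ b * (n + 1)) :
    |∑ k ∈ Finset.Icc (-(n : ℤ)) (n : ℤ), max 0 (s - b * |(k : ℝ)|) - s ^ 2 / b| ≤ s := by
  obtain ⟨l, u⟩ := aux_tel b (fun x => max 0 (s - x)) (fun x => (max 0 (s - x)) ^ 2 / 2) hb
    (by
      intro x
      rcases max_cases 0 (s - x) with ⟨h, h'⟩ | ⟨h, h'⟩ <;>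
      rcases max_cases 0 (s - (x + b)) with ⟨g, g'⟩ | ⟨g, g'⟩ <;> simp only [h, g] <;>
      nlinarith)
    (by
      intro x
      rcases max_cases 0 (s - x) with ⟨h, h'⟩ | ⟨h, h'⟩ <;>
      rcases max_cases 0 (s - (x + b)) with ⟨g, g'⟩ | ⟨g, g'⟩ <;> simp only [h, g] <;>
      nlinarith) n
  simp only [sub_zero] at l u
  rw [max_eq_right hs] at l u
  rw [max_eq_left (by linarith : s - b * ((n : ℝ) + 1) ≤ 0)] at l
  set X := ∑ k ∈ Finset.Icc (-(n : ℤ)) (n : ℤ), max 0 (s - b * |(k : ℝ)|)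
  have : X - s ^ 2 / b = (b * X - s ^ 2) / b := by field_simp
  rw [this, abs_div, abs_of_pos hb, div_le_iff₀ hb, abs_le]
  constructor
  · linarith
  · nlinarith [sq_nonneg (max 0 (s - b * (n : ℝ)))]

lemma aux_quad (b s : ℝ) (hb : 0 < b) (hs : 0 ≤ s) (n : ℕ) (hn : s ≤ b * (n + 1)) :
    |∑ k ∈ Finset.Icc (-(n : ℤ)) (n : ℤ), (max 0 (s - b * |(k : ℝ)|)) ^ 2 - 2 * s ^ 3 / (3 * b)|
      ≤ s ^ 2 := by
  have key : ∀ p q : ℝ, 0 ≤ q → q ≤ p → p - q ≤ b → p ^ 3 / 3 - q ^ 3 / 3 ≤ b * p ^ 2 := by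
    intro p q h0 h1 h2
    have : p ^ 3 / 3 - q ^ 3 / 3 = (p - q) * ((p ^ 2 + p * q + q ^ 2) / 3) := by ring
    rw [this]
    apply mul_le_mul h2 (by nlinarith) (by nlinarith [mul_nonneg (h0.trans h1) h0]) hb.le
  have key2 : ∀ p q : ℝ, 0 ≤ q → p - q = b → b * q ^ 2 ≤ p ^ 3 / 3 - q ^ 3 / 3 := by
    intro p q h0 h2
    have : p ^ 3 / 3 - q ^ 3 / 3 = (p - q) * ((p ^ 2 + p * q + q ^ 2) / 3) := by ring
    rw [this, h2]
    apply mul_le_mul_of_nonneg_left (by nlinarith) hb.le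
  obtain ⟨l, u⟩ := aux_tel b (fun x => (max 0 (s - x)) ^ 2) (fun x => (max 0 (s - x)) ^ 3 / 3) hb
    (by
      intro x
      apply key
      · exact le_max_left _ _
      · exact max_le_max le_rfl (by linarith)
      · rcases max_cases 0 (s - x) with ⟨h, h'⟩ | ⟨h, h'⟩ <;>
        rcases max_cases 0 (s - (x + b)) with ⟨g, g'⟩ | ⟨g, g'⟩ <;> simp only [h, g] <;>
        linarith)
    (by
      intro x
      rcases max_cases 0 (s - (x + b)) with ⟨g, g'⟩ | ⟨g, g'⟩
      · simp only [g]
        have : 0 ≤ (max 0 (s - x)) ^ 3 := pow_nonneg (le_max_left _ _) 3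
        norm_num
        linarith
      · apply key2
        · exact le_max_left _ _
        · rw [g, max_eq_right (by linarith)]; ring) n
  simp only [sub_zero] at l u
  rw [max_eq_right hs] at l u
  rw [max_eq_left (by linarith : s - b * ((n : ℝ) + 1) ≤ 0)] at l
  set X := ∑ k ∈ Finset.Icc (-(n : ℤ)) (n : ℤ), (max 0 (s - b * |(k : ℝ)|)) ^ 2
  have : X - 2 * s ^ 3 / (3 * b) = (b * X - 2 * s ^ 3 / 3) / b := by field_simp
  rw [this, abs_div, abs_of_pos hb, div_le_iff₀ hb, abs_le]
  have h3 : 0 ≤ (max 0 (s - b * (n : ℝ))) ^ 3 := pow_nonneg (le_max_left _ _) 3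
  constructor
  · linarith
  · linarith

lemma aux_count (lo hi c w : ℤ) (hc : 0 < c) :
    |(((Finset.Ico lo hi).filter (fun x => x ≡ w [ZMOD c])).card : ℝ)
      - max 0 ((hi : ℝ) - lo) / c| ≤ 1 := by
  have hcR : (0 : ℝ) < c := by exact_mod_cast hc
  by_cases h : lo < hi
  · have e := Int.Ico_filter_modEq_card lo hi hc w
    have hcQ : (0 : ℚ) < c := by exact_mod_cast hc
    have hQ : (lo : ℚ) < hi := by exact_mod_cast h
    have hle : ⌈((lo : ℚ) - w) / c⌉ ≤ ⌈((hi : ℚ) - w) / c⌉ := by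
      apply Int.ceil_le_ceil
      gcongr
    rw [max_eq_left (by linarith)] at e
    set N := ((Finset.Ico lo hi).filter (fun x => x ≡ w [ZMOD c])).card
    have e' : (N : ℚ) = (⌈((hi : ℚ) - w) / c⌉ : ℚ) - (⌈((lo : ℚ) - w) / c⌉ : ℚ) := by
      exact_mod_cast e
    have a1 := Int.le_ceil (((hi : ℚ) - w) / c)
    have a2 := Int.ceil_lt_add_one (((hi : ℚ) - w) / c)
    have a3 := Int.le_ceil (((lo : ℚ) - w) / c)
    have a4 := Int.ceil_lt_add_one (((lo : ℚ) - w) / c)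
    have e5 : ((hi : ℚ) - lo) / c = ((hi : ℚ) - w) / c - ((lo : ℚ) - w) / c := by ring
    have q : |(N : ℚ) - ((hi : ℚ) - lo) / c| ≤ 1 := by
      rw [abs_le]; constructor <;> linarith
    have hR : (lo : ℝ) < hi := by exact_mod_cast h
    rw [max_eq_right (by linarith)]
    exact_mod_cast q
  · have hR : (hi : ℝ) ≤ lo := by exact_mod_cast not_lt.mp h
    rw [max_eq_left (by linarith), Finset.Ico_eq_empty h]
    simp

lemma aux_S (t a b c : ℤ)
    (ht : 0 < t) (ha : 0 < a) (hb : 0 < b)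
    (hoc : Odd c) (r : ℤ) (n m : ℕ) (hn : t < a * (n + 1)) (hm : t < b * (m + 1)) :
    ∃ w : ℤ → ℤ → ℤ, (((Finset.Ico (0:ℤ) t ×ˢ Finset.Ico (0:ℤ) t) ×ˢ
          (Finset.Ico (0:ℤ) t ×ˢ Finset.Ico (0:ℤ) t)).filter
          (fun j => j.1.1 + j.1.2 = j.2.1 + j.2.2 ∧
            a ∣ (j.2.2 - j.1.2) ∧ b ∣ (j.2.1 - j.1.2) ∧
              c ∣ (j.2.1 + j.2.2 + 2 * r))).card =
      ∑ i ∈ Finset.Icc (-(n : ℤ)) n, ∑ k ∈ Finset.Icc (-(m : ℤ)) m,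
        ((Finset.Ico (max (a * i) 0 + max (b * k) 0) (t + min (a * i) 0 + min (b * k) 0)).filter
          (fun x => x ≡ w i k [ZMOD c])).card := by
  obtain ⟨d, hd⟩ := hoc
  refine ⟨fun i k => (d + 1) * (a * i + b * k) - r, ?_⟩
  have bnd : ∀ (a x : ℤ) (n : ℕ), 0 < a → t < a * (n + 1) → a * x < t → -t < a * x →
      -(n : ℤ) ≤ x ∧ x ≤ n := by
    intro a x n ha hn h1 h2
    have : a * x < a * (n + 1) := by linarith
    have := lt_of_mul_lt_mul_left this ha.le
    have h3 : a * (-x) < a * (n + 1) := by linarith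
    have := lt_of_mul_lt_mul_left h3 ha.le
    omega
  rw [← Finset.sum_product', ← Finset.card_sigma]
  symm
  apply Finset.card_bij (fun p _ => ((p.2 - a * p.1.1 - b * p.1.2, p.2),
    (p.2 - b * p.1.2, p.2 - a * p.1.1)))
  · rintro ⟨⟨i, k⟩, x⟩ h
    simp only [Finset.mem_sigma, Finset.mem_product, Finset.mem_filter, Finset.mem_Ico,
      Finset.mem_Icc] at h ⊢
    obtain ⟨h1, h2, h3⟩ := h
    refine ⟨by omega, by ring, ⟨-i, by ring⟩, ⟨-k, by ring⟩, ?_⟩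
    obtain ⟨q, hq⟩ := h3.symm.dvd
    refine ⟨2 * q + (a * i + b * k), ?_⟩
    have : x = c * q + ((d + 1) * (a * i + b * k) - r) := by linarith
    rw [this, hd]; ring
  · rintro ⟨⟨i, k⟩, x⟩ h ⟨⟨i', k'⟩, x'⟩ h' e
    simp only [Prod.mk.injEq] at e
    obtain ⟨⟨e1, e2⟩, e3, e4⟩ := e
    subst e2
    have : i = i' := mul_left_cancel₀ ha.ne' (by linarith)
    have : k = k' := mul_left_cancel₀ hb.ne' (by linarith)
    subst_vars
    rfl
  · rintro ⟨⟨j1, j2⟩, j3, j4⟩ h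
    simp only [Finset.mem_product, Finset.mem_filter, Finset.mem_Ico] at h
    obtain ⟨h1, h2, ⟨i, hi⟩, ⟨k, hk⟩, ⟨q, hq⟩⟩ := h
    have ei : a * -i = -(a * i) := by ring
    have ek : b * -k = -(b * k) := by ring
    refine ⟨⟨(-i, -k), j2⟩, ?_, ?_⟩
    · simp only [Finset.mem_sigma, Finset.mem_product, Finset.mem_filter, Finset.mem_Ico,
        Finset.mem_Icc]
      have b1 := bnd a (-i) n ha hn (by omega) (by omega)
      have b2 := bnd b (-k) m hb hm (by omega) (by omega)
      refine ⟨⟨b1, b2⟩, by omega, ?_⟩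
      apply Int.ModEq.symm
      rw [Int.modEq_iff_dvd]
      have hcop : IsCoprime c 2 := ⟨1, -d, by rw [hd]; ring⟩
      apply hcop.dvd_of_dvd_mul_left
      refine ⟨q + (a * i + b * k), ?_⟩
      have e3 : j3 = j2 + b * k := by linarith
      have e4 : j4 = j2 + a * i := by linarith
      rw [e3, e4] at hq
      have : 2 * r = c * q - (2 * j2 + b * k + a * i) := by linarith
      rw [ei, ek]
      have h5 : c * (q + (a * i + b * k)) = c * q + c * (a * i + b * k) := by ring
      rw [h5]
      have h6 : c * (a * i + b * k) = (2 * d + 1) * (a * i + b * k) := by rw [hd]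
      rw [h6]
      linear_combination this
    · simp only [Prod.mk.injEq]
      refine ⟨⟨?_, trivial⟩, ?_, ?_⟩ <;> linarith

theorem lattice_point_count_in_polyhedron (t a b c : ℤ)
    (ht : 0 < t) (ha : 0 < a) (hb : 0 < b) (hc : 0 < c)
    (hoa : Odd a) (hob : Odd b) (hoc : Odd c) (r : ℤ) :
    |((((Finset.Ico (0:ℤ) t ×ˢ Finset.Ico (0:ℤ) t) ×ˢ
          (Finset.Ico (0:ℤ) t ×ˢ Finset.Ico (0:ℤ) t)).filter
          (fun j => j.1.1 + j.1.2 = j.2.1 + j.2.2 ∧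
            a ∣ (j.2.2 - j.1.2) ∧ b ∣ (j.2.1 - j.1.2) ∧
              c ∣ (j.2.1 + j.2.2 + 2 * r))).card : ℝ)
        - 2 * (t : ℝ) ^ 3 / (3 * a * b * c)|
      ≤ 4572 * (max (t : ℝ) (max a (max b c))) ^ 2 * (max (a : ℝ) (max b c))
          / (a * b * c) := by
  have ex : ∀ a : ℤ, 0 < a → ∃ n : ℕ, t < a * (n + 1) ∧ a * n ≤ t := by
    intro a ha
    have h0 : 0 ≤ t / a := Int.ediv_nonneg ht.le ha.le
    refine ⟨(t / a).toNat, ?_, ?_⟩ <;> rw [Int.toNat_of_nonneg h0]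
    · have := Int.lt_ediv_add_one_mul_self t ha
      linarith
    · exact Int.mul_ediv_self_le ha.ne'
  obtain ⟨n, hn, hn'⟩ := ex a ha
  obtain ⟨m, hm, hm'⟩ := ex b hb
  obtain ⟨w, hw⟩ := aux_S t a b c ht ha hb hoc r n m hn hm
  rw [hw]
  clear hw
  have htR : (0 : ℝ) < t := by exact_mod_cast ht
  have haR : (0 : ℝ) < a := by exact_mod_cast ha
  have hbR : (0 : ℝ) < b := by exact_mod_cast hb
  have hcR : (0 : ℝ) < c := by exact_mod_cast hc
  have hnR : (t : ℝ) ≤ a * (n + 1) := by exact_mod_cast hn.le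
  have hmR : (t : ℝ) ≤ b * (m + 1) := by exact_mod_cast hm.le
  have hnR' : (a : ℝ) * n ≤ t := by exact_mod_cast hn'
  have hmR' : (b : ℝ) * m ≤ t := by exact_mod_cast hm'
  have card : ∀ n : ℕ, ((Finset.Icc (-(n : ℤ)) n).card : ℝ) = 2 * n + 1 := by
    intro n
    rw [Int.card_Icc]
    have : ((n : ℤ) + 1 - -(n : ℤ)).toNat = 2 * n + 1 := by omega
    rw [this]; push_cast; ring
  -- step 1
  have s1 : |((∑ i ∈ Finset.Icc (-(n : ℤ)) n, ∑ k ∈ Finset.Icc (-(m : ℤ)) m,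
        ((Finset.Ico (max (a * i) 0 + max (b * k) 0) (t + min (a * i) 0 + min (b * k) 0)).filter
          (fun x => x ≡ w i k [ZMOD c])).card : ℕ) : ℝ)
      - (∑ i ∈ Finset.Icc (-(n : ℤ)) n, ∑ k ∈ Finset.Icc (-(m : ℤ)) m,
        max 0 (max 0 ((t : ℝ) - a * |(i : ℝ)|) - b * |(k : ℝ)|)) / c|
      ≤ (2 * n + 1) * (2 * m + 1) := by
    push_cast
    rw [Finset.sum_div, ← Finset.sum_sub_distrib]
    refine (Finset.abs_sum_le_sum_abs _ _).trans ?_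
    rw [← card n, ← nsmul_eq_mul]
    apply Finset.sum_le_card_nsmul
    intro i _
    rw [Finset.sum_div, ← Finset.sum_sub_distrib]
    refine (Finset.abs_sum_le_sum_abs _ _).trans ?_
    rw [← card m, ← mul_one ((Finset.Icc (-(m : ℤ)) m).card : ℝ), ← nsmul_eq_mul]
    apply Finset.sum_le_card_nsmul
    intro k _
    have := aux_count (max (a * i) 0 + max (b * k) 0) (t + min (a * i) 0 + min (b * k) 0) c
      (w i k) hc
    have abs' : ∀ y : ℤ, max y 0 - min y 0 = |y| := fun y => by
      rw [max_sub_min_eq_abs]; simp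
    have e : ((t + min (a * i) 0 + min (b * k) 0 : ℤ) : ℝ)
        - ((max (a * i) 0 + max (b * k) 0 : ℤ) : ℝ) = t - a * |(i : ℝ)| - b * |(k : ℝ)| := by
      have h1 := abs' (a * i)
      have h2 := abs' (b * k)
      rw [abs_mul, abs_of_pos ha] at h1
      rw [abs_mul, abs_of_pos hb] at h2
      have : (t + min (a * i) 0 + min (b * k) 0) - (max (a * i) 0 + max (b * k) 0)
        = t - a * |i| - b * |k| := by linarith
      exact_mod_cast this
    rw [e] at this
    refine le_of_eq_of_le ?_ this
    have : 0 ≤ (b : ℝ) * |(k : ℝ)| := by positivity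
    rcases le_total 0 ((t : ℝ) - a * |(i : ℝ)|) with h | h
    · rw [max_eq_right h]
    · rw [max_eq_left h, max_eq_left (by linarith : (0 : ℝ) - b * |(k : ℝ)| ≤ 0),
        max_eq_left (by linarith : (t : ℝ) - a * |(i : ℝ)| - b * |(k : ℝ)| ≤ 0)]
  -- step 2
  have s2 : |∑ i ∈ Finset.Icc (-(n : ℤ)) n, ∑ k ∈ Finset.Icc (-(m : ℤ)) m,
        max 0 (max 0 ((t : ℝ) - a * |(i : ℝ)|) - b * |(k : ℝ)|)
      - (∑ i ∈ Finset.Icc (-(n : ℤ)) n, (max 0 ((t : ℝ) - a * |(i : ℝ)|)) ^ 2) / b|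
      ≤ (2 * n + 1) * t := by
    rw [Finset.sum_div, ← Finset.sum_sub_distrib]
    refine (Finset.abs_sum_le_sum_abs _ _).trans ?_
    rw [← card n, ← nsmul_eq_mul]
    apply Finset.sum_le_card_nsmul
    intro i _
    have hle : max 0 ((t : ℝ) - a * |(i : ℝ)|) ≤ t := by
      apply max_le htR.le
      have : 0 ≤ (a : ℝ) * |(i : ℝ)| := by positivity
      linarith
    exact (aux_lin b _ hbR (le_max_left _ _) m (hle.trans hmR)).trans hle
  have s3 := aux_quad a t haR htR.le n hnR
  set X := ((∑ i ∈ Finset.Icc (-(n : ℤ)) n, ∑ k ∈ Finset.Icc (-(m : ℤ)) m,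
        ((Finset.Ico (max (a * i) 0 + max (b * k) 0) (t + min (a * i) 0 + min (b * k) 0)).filter
          (fun x => x ≡ w i k [ZMOD c])).card : ℕ) : ℝ)
  set Y := ∑ i ∈ Finset.Icc (-(n : ℤ)) n, ∑ k ∈ Finset.Icc (-(m : ℤ)) m,
        max 0 (max 0 ((t : ℝ) - a * |(i : ℝ)|) - b * |(k : ℝ)|)
  set Z := ∑ i ∈ Finset.Icc (-(n : ℤ)) n, (max 0 ((t : ℝ) - a * |(i : ℝ)|)) ^ 2
  set M := max (t : ℝ) (max a (max b c))
  set μ := max (a : ℝ) (max b c)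
  have hμa : (a : ℝ) ≤ μ := le_max_left _ _
  have hμb : (b : ℝ) ≤ μ := (le_max_left _ _).trans (le_max_right _ _)
  have hμc : (c : ℝ) ≤ μ := (le_max_right _ _).trans (le_max_right _ _)
  have hMμ : μ ≤ M := le_max_right _ _
  have hMt : (t : ℝ) ≤ M := le_max_left _ _
  have hμ : 0 < μ := haR.trans_le hμa
  have hM : 0 < M := hμ.trans_le hMμ
  have p1 : (a : ℝ) * (2 * n + 1) ≤ 3 * M := by linarith
  have p2 : (b : ℝ) * (2 * m + 1) ≤ 3 * M := by linarith
  rw [le_div_iff₀ (by positivity)]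
  have E : |X - 2 * (t : ℝ) ^ 3 / (3 * a * b * c)| ≤
      (2 * (n : ℝ) + 1) * (2 * (m : ℝ) + 1) + (2 * (n : ℝ) + 1) * (t : ℝ) / (c : ℝ)
        + (t : ℝ) ^ 2 / ((b : ℝ) * c) := by
    have d : X - 2 * (t : ℝ) ^ 3 / (3 * a * b * c) = (X - Y / c) + (Y - Z / b) / c
        + (Z - 2 * (t : ℝ) ^ 3 / (3 * a)) / (b * c) := by
      field_simp
      ring
    rw [d]
    refine (abs_add_three _ _ _).trans ?_
    rw [abs_div, abs_div, abs_of_pos hcR, abs_of_pos (mul_pos hbR hcR)]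
    gcongr
  have F : ((2 * n + 1) * (2 * m + 1) + (2 * n + 1) * t / c + (t : ℝ) ^ 2 / (b * c)) * (a * b * c)
      = (a * (2 * n + 1)) * (b * (2 * m + 1)) * c + (a * (2 * n + 1)) * t * b + t * t * a := by
    field_simp
  calc _ ≤ _ := mul_le_mul_of_nonneg_right E (by positivity)
    _ = _ := F
    _ ≤ (3 * M) * (3 * M) * μ + (3 * M) * M * μ + M * M * μ := by gcongr
    _ ≤ _ := by nlinarith [mul_pos (mul_pos hM hM) hμ]
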